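/- If q ≥ (d−1)^4 + 6d, where d := gcd(k, q−1), then every matrix in M_n(𝔽_q) can be written as A^k + B^k where A and B are split semisimple matrices in M_n(𝔽_q). -/

import Mathlib

/-- A matrix over a field is split semisimple (diagonalizable) if it is
similar over the field to a diagonal matrix. -/
def IsSplitSemisimple {n : ℕ} {F : Type*} [Field F]
    (A : Matrix (Fin n) (Fin n) F) : Prop :=
  ∃ (g : GL (Fin n) F) (d : Fin n → F),
    (↑g : Matrix (Fin n) (Fin n) F) * A * (↑g⁻¹ : Matrix (Fin n) (Fin n) F) =
      Matrix.diagonal d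

section NT
open Finset

lemma jac_norm_le_one {F : Type*} [Field F] [Fintype F] {χ φ : MulChar F ℂ}
    (h : χ ≠ 1 ∨ φ ≠ 1) (h' : χ = 1 ∨ φ = 1 ∨ χ * φ = 1) : ‖jacobiSum χ φ‖ ≤ 1 := by
  by_cases h1 : χ = 1
  · subst h1
    rw [jacobiSum_one_nontrivial (by simpa using h)]; simp
  by_cases h2 : φ = 1
  · subst h2
    rw [jacobiSum_comm, jacobiSum_one_nontrivial h1]; simp
  have h3 : χ * φ = 1 := by tauto
  have : φ = χ⁻¹ := eq_inv_of_mul_eq_one_right h3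
  subst this
  rw [jacobiSum_nontrivial_inv h1, norm_neg]
  by_contra hc
  have : χ (-1) * χ (-1) = 1 := by rw [← map_mul]; simp
  have := congrArg norm this
  rw [norm_mul, norm_one] at this
  push Not at hc
  nlinarith

lemma jac_norm {F : Type*} [Field F] [Fintype F] {χ φ : MulChar F ℂ}
    (h1 : χ ≠ 1) (h2 : φ ≠ 1) (h3 : χ * φ ≠ 1) :
    ‖jacobiSum χ φ‖ ≤ Real.sqrt (Fintype.card F) := by
  have hch : ringChar ℂ ≠ ringChar F := by
    rw [ringChar.eq_zero (R := ℂ)]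
    exact (CharP.ringChar_ne_zero_of_finite F).symm
  have := jacobiSum_mul_jacobiSum_inv hch h1 h2 h3
  have hc : jacobiSum χ⁻¹ φ⁻¹ = (starRingEnd ℂ) (jacobiSum χ φ) := by
    simp only [jacobiSum, map_sum, map_mul]
    refine Finset.sum_congr rfl fun x _ => ?_
    rw [← MulChar.star_apply', ← MulChar.star_apply']; rfl
  rw [hc, Complex.mul_conj] at this
  have h5 : Complex.normSq (jacobiSum χ φ) = Fintype.card F := by exact_mod_cast this
  rw [Complex.normSq_eq_norm_sq] at h5
  exact Real.le_sqrt_of_sq_le h5.le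

lemma sum_bound (d : ℕ) (hd : 1 ≤ d) (r : ℝ) :
    ∑ i ∈ range d, ∑ j ∈ range d, (if i = 0 ∧ j = 0 then 0 else
      if i = 0 ∨ j = 0 ∨ i + j = d then 1 else r) = 3 * (d - 1) + (d - 1) * (d - 2) * r := by
  obtain ⟨e, rfl⟩ : ∃ e, d = e + 1 := ⟨d - 1, by omega⟩
  rw [Finset.sum_range_succ']
  have h0 : ∑ j ∈ range (e + 1), (if (0:ℕ) = 0 ∧ j = 0 then (0:ℝ) else
      if (0:ℕ) = 0 ∨ j = 0 ∨ 0 + j = e + 1 then 1 else r) = e := by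
    rw [Finset.sum_range_succ']; simp
  rw [h0]
  have h1 : ∀ i ∈ range e, ∑ j ∈ range (e + 1), (if i + 1 = 0 ∧ j = 0 then (0:ℝ) else
      if i + 1 = 0 ∨ j = 0 ∨ i + 1 + j = e + 1 then 1 else r) = 2 + (e - 1) * r := by
    intro i hi
    rw [mem_range] at hi
    have : ∀ j ∈ range (e+1), (if i + 1 = 0 ∧ j = 0 then (0:ℝ) else
      if i + 1 = 0 ∨ j = 0 ∨ i + 1 + j = e + 1 then 1 else r) =
        r + (if j = 0 then 1 - r else 0) + (if j = e - i then 1 - r else 0) := by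
      intro j hj
      rw [mem_range] at hj
      have : i + 1 + j = e + 1 ↔ j = e - i := by omega
      simp only [this]
      have : ¬ (j = 0 ∧ j = e - i) := by omega
      by_cases h1 : j = 0 <;> by_cases h2 : j = e - i <;> simp_all
    rw [Finset.sum_congr rfl this, sum_add_distrib, sum_add_distrib, Finset.sum_ite_eq',
      Finset.sum_ite_eq']
    have : e - i < e + 1 := by omega
    simp [this]; ring
  rw [Finset.sum_congr rfl h1]
  simp; ring

lemma geom_char {F : Type*} [Field F] [Fintype F] [DecidableEq F] (χ : MulChar F ℂ) (d : ℕ) (hd : 1 ≤ d)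
    (hχ : χ ^ d = 1) (x : F) : ∑ i ∈ range d, (χ ^ i) x = if χ x = 1 then (d : ℂ) else 0 := by
  by_cases hx : x = 0
  · subst hx; simp [MulChar.map_zero]
  have : ∀ i, (χ ^ i) x = (χ x) ^ i := fun i => MulChar.pow_apply_coe χ i (Units.mk0 x hx)
  simp only [this]
  split_ifs with h
  · simp [h]
  · have h1 : χ x ^ d = 1 := by rw [← this, hχ, MulChar.one_apply (Ne.isUnit hx)]
    have := geom_sum_mul (χ x) d
    rw [h1, sub_self] at this
    exact (mul_eq_zero.mp this).resolve_right (sub_ne_zero.mpr h)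

lemma real_ineq (d q : ℕ) (hd : 1 ≤ d) (hq : q ≥ (d - 1) ^ 4 + 6 * d) :
    (q : ℝ) - 2 - (3 * (d - 1) + (d - 1) * (d - 2) * Real.sqrt q) > d ^ 2 := by
  obtain ⟨e, rfl⟩ : ∃ e, d = e + 1 := ⟨d - 1, by omega⟩
  have hq' : (q : ℝ) ≥ (e:ℝ) ^ 4 + 6 * (e + 1) := by
    have := hq; simp only [Nat.add_sub_cancel] at this; exact_mod_cast this
  have h2 := Real.sq_sqrt (Nat.cast_nonneg (α := ℝ) q)
  have h0 := Real.sqrt_nonneg (q:ℝ)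
  set r := Real.sqrt q
  rw [← h2] at hq' ⊢
  push_cast
  have he : (0:ℝ) ≤ e := Nat.cast_nonneg e
  have hre : (e:ℝ)^2 < r := by
    apply lt_of_pow_lt_pow_left₀ 2 h0; nlinarith
  have h3 : r * (r - e^2) ≥ 3 * (e + 1) := by nlinarith
  rcases Nat.eq_zero_or_pos e with h | h
  · subst h; norm_num at *; nlinarith
  have he1 : (1:ℝ) ≤ e := by exact_mod_cast h
  have h4 : (e:ℝ) + 2 < r := by
    apply lt_of_pow_lt_pow_left₀ 2 h0
    nlinarith [pow_le_pow_right₀ he1 (show 2 ≤ 4 by norm_num)]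
  nlinarith [mul_lt_mul_of_pos_left h4 (by linarith : (0:ℝ) < e)]

lemma two_reps {F : Type*} [Field F] [Fintype F] [DecidableEq F] (χ : MulChar F ℂ) (d : ℕ)
    (hd : 1 ≤ d) (hχ : orderOf χ = d) (hq : Fintype.card F ≥ (d - 1) ^ 4 + 6 * d) (s : F) (hs : s ≠ 0) :
    1 < #{x : F | χ x = 1 ∧ χ (s - x) = 1} := by
  have hχd : χ ^ d = 1 := hχ ▸ pow_orderOf_eq_one χ
  set R := #{x : F | χ x = 1 ∧ χ (s - x) = 1} with hR
  have hpow : ∀ i < d, i ≠ 0 → χ ^ i ≠ 1 := by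
    intro i hi h0 h1
    exact pow_ne_one_of_lt_orderOf h0 (hχ ▸ hi) h1
  have key : (d : ℂ) ^ 2 * R = ∑ i ∈ range d, ∑ j ∈ range d,
      (χ ^ i * χ ^ j) s * jacobiSum (χ ^ i) (χ ^ j) := by
    have h1 : (d : ℂ) ^ 2 * R = ∑ x : F, (∑ i ∈ range d, (χ ^ i) x) * (∑ j ∈ range d, (χ ^ j) (s - x)) := by
      simp only [geom_char χ d hd hχd]
      rw [hR, Finset.card_filter]
      push_cast
      rw [Finset.mul_sum]
      refine Finset.sum_congr rfl fun x _ => ?_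
      by_cases h1 : χ x = 1 <;> by_cases h2 : χ (s - x) = 1 <;> simp [h1, h2, sq]
    rw [h1]
    simp only [Finset.sum_mul_sum]
    rw [Finset.sum_comm]
    refine Finset.sum_congr rfl fun i _ => ?_
    rw [Finset.sum_comm]
    refine Finset.sum_congr rfl fun j _ => ?_
    rw [← Equiv.sum_comp (Equiv.mulLeft₀ s hs), jacobiSum, Finset.mul_sum]
    refine Finset.sum_congr rfl fun x _ => ?_
    have : s - s * x = s * (1 - x) := by ring
    simp only [Equiv.mulLeft₀_apply, this, map_mul, MulChar.mul_apply]
    ring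
  have hnorm : ‖(d : ℂ) ^ 2 * R - (Fintype.card F - 2)‖ ≤
      3 * (d - 1) + (d - 1) * (d - 2) * Real.sqrt (Fintype.card F) := by
    rw [← sum_bound d hd, key]
    have h00 : ((Fintype.card F : ℂ) - 2) = ∑ i ∈ range d, ∑ j ∈ range d,
        if i = 0 ∧ j = 0 then ((Fintype.card F : ℂ) - 2) else 0 := by
      obtain ⟨e, rfl⟩ : ∃ e, d = e + 1 := ⟨d - 1, by omega⟩
      rw [Finset.sum_range_succ', Finset.sum_range_succ']
      simp
    rw [h00, ← Finset.sum_sub_distrib]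
    refine (norm_sum_le _ _).trans (Finset.sum_le_sum fun i hi => ?_)
    rw [← Finset.sum_sub_distrib]
    refine (norm_sum_le _ _).trans (Finset.sum_le_sum fun j hj => ?_)
    rw [mem_range] at hi hj
    have hs1 : ∀ ψ : MulChar F ℂ, ψ ^ d = 1 → ‖ψ s‖ = 1 := by
      intro ψ hψ
      have : ψ s ^ d = 1 := by
        rw [← MulChar.pow_apply' ψ (by omega), hψ, MulChar.one_apply (Ne.isUnit hs)]
      exact Complex.norm_eq_one_of_pow_eq_one this (by omega)
    have hsij : ‖(χ ^ i * χ ^ j) s‖ = 1 := by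
      apply hs1
      rw [← pow_add, ← pow_mul, mul_comm, pow_mul, hχd, one_pow]
    by_cases h1 : i = 0 ∧ j = 0
    · obtain ⟨rfl, rfl⟩ := h1
      simp [jacobiSum_one_one, MulChar.one_apply (Ne.isUnit hs)]
    · rw [if_neg h1, if_neg h1, sub_zero, norm_mul, hsij, one_mul]
      split_ifs with h2
      · apply jac_norm_le_one
        · by_cases hi0 : i = 0
          · exact Or.inr (hpow j hj (by tauto))
          · exact Or.inl (hpow i hi hi0)
        · rcases h2 with h | h | h
          · left; simp [h]
          · right; left; simp [h]
          · right; right; rw [← pow_add, h, hχd]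
      · push Not at h2
        apply jac_norm (hpow i hi h2.1) (hpow j hj h2.2.1)
        rw [← pow_add]
        intro h
        have := orderOf_dvd_of_pow_eq_one h
        rw [hχ] at this
        obtain ⟨c, hc⟩ := this
        have hc2 : c < 2 := by
          by_contra hcc
          have : d * 2 ≤ d * c := Nat.mul_le_mul_left _ (by omega)
          omega
        interval_cases c <;> omega
  have hcast : ‖(d : ℂ) ^ 2 * R - (Fintype.card F - 2)‖ = |(d:ℝ)^2 * R - (Fintype.card F - 2)| := by
    rw [← Real.norm_eq_abs, ← Complex.norm_real]; push_cast; rfl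
  rw [hcast] at hnorm
  have h1 := (abs_le.mp hnorm).1
  have h2 := real_ineq d _ hd hq
  have h3 : (d:ℝ)^2 * 1 < d^2 * R := by linarith
  have h4 : (1:ℝ) < R := lt_of_mul_lt_mul_left h3 (by positivity)
  exact_mod_cast h4

/-- the exponent `m` -/
lemma nt_main {F : Type*} [Field F] [Fintype F] (k d : ℕ) (hk : 1 ≤ k)
    (hd : d = Nat.gcd k (Fintype.card F - 1))
    (hq : Fintype.card F ≥ (d - 1) ^ 4 + 6 * d) :
    ∃ m : ℕ, 1 ≤ m ∧ m ∣ Fintype.card F - 1 ∧ (∀ x : F, x ^ m = 1 → ∃ y, y ^ k = x) ∧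
      ∀ s : F, s ≠ 0 → ∃ a b : F, a + b = s ∧ a ^ m = 1 ∧ b ^ m = 1 ∧ b ≠ 1 := by
  classical
  have hd1 : 1 ≤ d := hd ▸ Nat.gcd_pos_of_pos_left _ hk
  have hdq : d ∣ Fintype.card F - 1 := hd ▸ Nat.gcd_dvd_right _ _
  obtain ⟨m, hm⟩ := hdq
  have hcard : 1 < Fintype.card F := Fintype.one_lt_card
  have hm1 : 1 ≤ m := by
    rcases Nat.eq_zero_or_pos m with h | h
    · subst h; omega
    · exact h
  obtain ⟨χ, hχ⟩ := MulChar.exists_mulChar_orderOf F (R := ℂ) (n := d) ⟨m, hm⟩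
    (Complex.isPrimitiveRoot_exp d (by omega))
  obtain ⟨g, hg⟩ := IsCyclic.exists_generator (α := Fˣ)
  have hgo : orderOf g = d * m := by
    rw [orderOf_eq_card_of_forall_mem_zpowers hg, Nat.card_eq_fintype_card, Fintype.card_units, hm]
  have hpw : ∀ x : Fˣ, ∃ j : ℕ, g ^ j = x := fun x =>
    (Submonoid.mem_powers_iff _ _).mp (mem_powers_iff_mem_zpowers.mpr (hg x))
  have hker : ∀ x : F, χ x = 1 → x ^ m = 1 := by
    intro x hx
    have hx0 : x ≠ 0 := by rintro rfl; simp [MulChar.map_zero] at hx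
    obtain ⟨j, hj⟩ := hpw (Units.mk0 x hx0)
    have hj' : x = (g : F) ^ j := by
      have := congrArg Units.val hj; simpa using this.symm
    have h1 : χ ^ j = 1 := by
      rw [MulChar.eq_iff hg]
      rw [MulChar.pow_apply_coe, ← map_pow, ← hj', hx]; simp
    have h2 : d ∣ j := hχ ▸ orderOf_dvd_of_pow_eq_one h1
    obtain ⟨c, rfl⟩ := h2
    have : g ^ (d * m) = 1 := hgo ▸ pow_orderOf_eq_one g
    rw [hj', ← pow_mul, mul_right_comm, pow_mul, ← Units.val_pow_eq_pow_val, this]; simp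
  refine ⟨m, hm1, ⟨d, by rw [hm, mul_comm]⟩, ?_, ?_⟩
  · intro x hx
    have hx0 : x ≠ 0 := by rintro rfl; rw [zero_pow (by omega)] at hx; exact zero_ne_one hx
    obtain ⟨j, hj⟩ := hpw (Units.mk0 x hx0)
    have hj' : x = (g : F) ^ j := by
      have := congrArg Units.val hj; simpa using this.symm
    have h1 : g ^ (j * m) = 1 := by
      apply Units.ext; rw [Units.val_pow_eq_pow_val, pow_mul, ← hj', hx]; rfl
    have h2 : d ∣ j := by
      have := orderOf_dvd_of_pow_eq_one h1
      rw [hgo] at this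
      exact Nat.dvd_of_mul_dvd_mul_right hm1 this
    obtain ⟨c, rfl⟩ := h2
    have hb := Nat.gcd_eq_gcd_ab k (Fintype.card F - 1)
    rw [← hd] at hb
    refine ⟨((g ^ (Nat.gcdA k (Fintype.card F - 1) * c) : Fˣ) : F), ?_⟩
    rw [hj', ← Units.val_pow_eq_pow_val, ← Units.val_pow_eq_pow_val]
    congr 1
    rw [← zpow_natCast, ← zpow_natCast, ← zpow_mul]
    push_cast
    rw [hb, add_mul, zpow_add]
    have : g ^ (((Fintype.card F - 1 : ℕ) : ℤ) * Nat.gcdB k (Fintype.card F - 1) * c) = 1 := by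
      rw [hm, ← hgo, mul_assoc, zpow_mul, zpow_natCast, pow_orderOf_eq_one, one_zpow]
    rw [this, mul_one]
    congr 1; ring
  · intro s hs
    obtain ⟨x, hx, y, hy, hxy⟩ := Finset.one_lt_card.mp (two_reps χ d hd1 hχ hq s hs)
    simp only [mem_filter, mem_univ, true_and] at hx hy
    by_cases h : s - x = 1
    · refine ⟨y, s - y, by ring, hker _ hy.1, hker _ hy.2, fun h' => hxy ?_⟩
      linear_combination h' - h
    · exact ⟨x, s - x, by ring, hker _ hx.1, hker _ hx.2, h⟩

end NT

section LA
open Finset Polynomial Module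

def GoodEnd {F V : Type*} [Field F] [AddCommGroup V] [Module F V] (m : ℕ) (T : Module.End F V) : Prop :=
  ∃ a b : Module.End F V, T = a + b ∧ a ^ (m + 1) = a ∧ b ^ (m + 1) = b

lemma pow_apply_eig {F V : Type*} [Field F] [AddCommGroup V] [Module F V] (A : Module.End F V)
    (c : F) (v : V) (h : A v = c • v) (n : ℕ) : (A ^ n) v = c ^ n • v := by
  induction n with
  | zero => simp
  | succ n ih => rw [pow_succ', Module.End.mul_apply, ih, map_smul, h, smul_smul, ← pow_succ]

lemma pow_apply_idem {F V : Type*} [Field F] [AddCommGroup V] [Module F V] (A : Module.End F V)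
    (v : V) (h : A (A v) = A v) (n : ℕ) : (A ^ (n + 1)) v = A v := by
  rw [pow_succ, Module.End.mul_apply, pow_apply_eig A 1 (A v) (by simpa using h)]; simp

lemma good_of_basis {F V : Type*} [Field F] [AddCommGroup V] [Module F V] (m l : ℕ) (hm : 1 ≤ m)
    (T : Module.End F V) (u : Basis (Fin (l + 1)) F V) (x : ℕ → F)
    (hx1 : ∀ j < l, x j = 1) (hxl : x l = 0 ∨ x l = 1)
    (hT : ∀ j : ℕ, ∀ h : j + 1 < l + 1, T (u ⟨j + 1, h⟩) = x (j + 1) • u ⟨j + 1, h⟩ + u ⟨j, by omega⟩)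
    (a b : F) (hab : a + b = u.repr (T (u 0)) 0) (ha : a ^ m = 1) (hb : b ^ m = 1) (hb1 : b ≠ 1) :
    GoodEnd m T := by
  have hx : ∀ j ≤ l, x j = 0 ∨ x j = 1 := by
    intro j hj
    rcases Nat.lt_or_ge j l with h | h
    · exact Or.inr (hx1 j h)
    · obtain rfl : j = l := by omega
      exact hxl
  let c : ℕ → F := fun j => if j = 0 then a else x j
  have hc : ∀ j ≤ l, c j ^ (m + 1) = c j := by
    intro j hj
    by_cases h : j = 0
    · simp [c, h, pow_succ, ha]
    · rcases hx j hj with h' | h' <;> simp [c, h, h']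
  have hc1 : ∀ j < l, c j ^ m = 1 := by
    intro j hj
    by_cases h : j = 0
    · simp [c, h, ha]
    · simp [c, h, hx1 j hj]
  let A : Module.End F V := u.constr F (fun j : Fin (l + 1) =>
    if Even (j : ℕ) then c j • u j else u ⟨(j : ℕ) - 1, by omega⟩)
  have hAe : ∀ j : Fin (l + 1), Even (j : ℕ) → A (u j) = c j • u j := by
    intro j hj
    refine (Basis.constr_basis u F _ j).trans ?_
    rw [if_pos hj]
  have hAo : ∀ j : ℕ, ∀ h : j + 1 < l + 1, Even j → A (u ⟨j + 1, h⟩) = u ⟨j, by omega⟩ := by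
    intro j h hj
    have : ¬ Even (j + 1) := by simpa [Nat.even_add_one] using hj
    refine (Basis.constr_basis u F _ _).trans ?_
    rw [if_neg this]; rfl
  refine ⟨A, T - A, by abel, ?_, ?_⟩
  · refine u.ext fun j => ?_
    by_cases hj : Even (j : ℕ)
    · rw [pow_apply_eig A _ _ (hAe j hj), hc _ (by omega), hAe j hj]
    · obtain ⟨j, hjl⟩ := j
      obtain ⟨i, rfl⟩ : ∃ i, j = i + 1 := ⟨j - 1, by
        have : j ≠ 0 := by rintro rfl; simp at hj
        omega⟩
      have hi : Even i := by
        simp only [Nat.even_add_one, not_not] at hj; exact hj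
      rw [pow_succ, Module.End.mul_apply, hAo i hjl hi, pow_apply_eig A _ _ (hAe _ hi),
        hc1 i (by omega), one_smul]
  · set B := T - A with hB
    have hBo : ∀ j : ℕ, ∀ h : j + 1 < l + 1, Even j → B (u ⟨j + 1, h⟩) = x (j + 1) • u ⟨j + 1, h⟩ := by
      intro j h hj
      rw [hB, LinearMap.sub_apply, hT j h, hAo j h hj]; abel
    have hBe : ∀ j : ℕ, ∀ h : j + 1 < l + 1, ¬ Even j → B (u ⟨j + 1, h⟩) = u ⟨j, by omega⟩ := by
      intro j h hj
      rw [hB, LinearMap.sub_apply, hT j h, hAe ⟨j + 1, h⟩ (by simpa [Nat.even_add_one] using hj)]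
      simp [c]
    have hidem : ∀ j : ℕ, ∀ h : j + 1 < l + 1, B (B (u ⟨j + 1, h⟩)) = B (u ⟨j + 1, h⟩) := by
      intro j h
      by_cases hj : Even j
      · rw [hBo j h hj, map_smul, hBo j h hj, smul_smul]
        rcases hx (j + 1) (by omega) with h' | h' <;> simp [h']
      · rw [hBe j h hj]
        obtain ⟨i, rfl⟩ : ∃ i, j = i + 1 := ⟨j - 1, by
          have : j ≠ 0 := by rintro rfl; simp at hj
          omega⟩
        have hi : Even i := by
          simp only [Nat.even_add_one, not_not] at hj; exact hj
        rw [hBo i (by omega) hi, hx1 (i + 1) (by omega), one_smul]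
    let w : V := ∑ j : Fin l, u.repr (T (u 0)) j.succ • u j.succ
    have hw : B (u 0) = b • u 0 + w := by
      have h1 : T (u 0) = (a + b) • u 0 + w := by
        conv_lhs => rw [← u.sum_repr (T (u 0))]
        rw [Fin.sum_univ_succ, hab]
      have h2 : A (u 0) = a • u 0 := by rw [hAe 0 (by simp)]; simp [c]
      rw [hB, LinearMap.sub_apply, h1, h2, add_smul]; abel
    have hwi : B (B w) = B w := by
      simp only [w, map_sum, map_smul]
      refine Finset.sum_congr rfl fun j _ => ?_
      have := hidem j.1 (by omega)
      exact congrArg _ this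
    have hb0 : b ≠ 0 := by rintro rfl; rw [zero_pow (by omega)] at hb; exact zero_ne_one hb
    have hb1' : 1 - b ≠ 0 := sub_ne_zero.mpr hb1.symm
    refine u.ext fun j => ?_
    obtain ⟨j, hjl⟩ := j
    rcases j with _ | j
    · change (B ^ (m + 1)) (u 0) = B (u 0)
      let z : V := b⁻¹ • (w - B w) - (1 - b)⁻¹ • B w
      have hBz : B z = - (1 - b)⁻¹ • B w := by
        simp only [z, map_sub, map_smul, hwi]; simp
      have hzi : B (B z) = B z := by rw [hBz, map_smul, hwi]
      have he : B (u 0 + z) = b • (u 0 + z) := by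
        rw [map_add, hBz, hw]
        simp only [z]
        match_scalars <;> field_simp
        ring
      have h1 : u 0 = (u 0 + z) - z := by abel
      rw [h1, LinearMap.map_sub (B ^ (m + 1)) (u 0 + z) z, LinearMap.map_sub B (u 0 + z) z,
        pow_apply_idem B z hzi, pow_apply_eig B b _ he, he, pow_succ, hb, one_mul]
    · exact pow_apply_idem B _ (hidem j hjl) m

lemma exists_cyc_basis {F : Type*} [Field F] (p : F[X]) (l : ℕ) (hp : p.natDegree = l + 1) (x : ℕ → F) :
    ∃ u : Basis (Fin (l + 1)) F (F[X] ⧸ (F[X] ∙ p)), ∀ j : ℕ, ∀ h : j + 1 < l + 1,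
      (X : F[X]) • (u ⟨j + 1, h⟩) = x (j + 1) • u ⟨j + 1, h⟩ + u ⟨j, by omega⟩ := by
  let S : Polynomial.Sequence F :=
    { elems' := fun i => ∏ t ∈ range i, (X - C (x (l - t)))
      degree_eq' := fun i => by simp [Polynomial.degree_prod] }
  have hS : ∀ i, S i = ∏ t ∈ range i, (X - C (x (l - t))) := fun i => rfl
  let f : Fin (l + 1) → F[X] := fun j => S (l - j)
  have hLI : LinearIndependent F f := by
    refine S.linearIndependent.comp (fun j : Fin (l + 1) => l - (j : ℕ)) ?_
    intro i j hij
    simp only at hij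
    ext; omega
  let v : Fin (l + 1) → F[X] ⧸ (F[X] ∙ p) := fun j => Submodule.Quotient.mk (f j)
  have hp0 : p ≠ 0 := by rintro rfl; simp at hp
  have hv : LinearIndependent F v := by
    rw [Fintype.linearIndependent_iff] at hLI ⊢
    intro g hg
    apply hLI g
    have h1 : (Submodule.Quotient.mk (∑ i, g i • f i) : F[X] ⧸ (F[X] ∙ p)) = 0 := by
      rw [← hg]
      simp only [v, ← Submodule.Quotient.mk_smul]
      exact map_sum (Submodule.mkQ (F[X] ∙ p)) _ _
    rw [Submodule.Quotient.mk_eq_zero, Submodule.mem_span_singleton] at h1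
    obtain ⟨r, hr⟩ := h1
    apply Polynomial.eq_zero_of_dvd_of_degree_lt (p := p) ⟨r, by rw [← hr, smul_eq_mul, mul_comm]⟩
    rw [Polynomial.degree_eq_natDegree hp0, hp]
    refine lt_of_le_of_lt (Polynomial.degree_sum_le _ _) ?_
    rw [Finset.sup_lt_iff (by exact WithBot.bot_lt_coe _)]
    intro i _
    refine lt_of_le_of_lt (Polynomial.degree_smul_le _ _) ?_
    simp only [f, S.degree_eq]
    exact_mod_cast (by omega : l - (i:ℕ) < l + 1)
  have hfr : Fintype.card (Fin (l + 1)) = Module.finrank F (F[X] ⧸ (F[X] ∙ p)) := by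
    rw [Fintype.card_fin, ← hp]
    exact (finrank_quotient_span_eq_natDegree (f := p)).symm
  refine ⟨basisOfLinearIndependentOfCardEqFinrank hv hfr, ?_⟩
  intro j h
  simp only [coe_basisOfLinearIndependentOfCardEqFinrank, v, f]
  rw [← Submodule.Quotient.mk_smul, ← Submodule.Quotient.mk_smul, ← Submodule.Quotient.mk_add]
  congr 1
  have : l - j = (l - (j + 1)) + 1 := by omega
  rw [this, hS, hS, Finset.prod_range_succ]
  have : l - (l - (j + 1)) = j + 1 := by omega
  rw [this, smul_eq_mul, Polynomial.smul_eq_C_mul]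
  ring

lemma good_cyclic {F : Type*} [Field F] (m : ℕ) (hm : 1 ≤ m)
    (H : ∀ s : F, s ≠ 0 → ∃ a b : F, a + b = s ∧ a ^ m = 1 ∧ b ^ m = 1 ∧ b ≠ 1)
    (p : F[X]) (hp : p ≠ 0) : GoodEnd m (Algebra.lsmul F F (F[X] ⧸ (F[X] ∙ p)) (X : F[X])) := by
  set T : Module.End F (F[X] ⧸ (F[X] ∙ p)) := Algebra.lsmul F F (F[X] ⧸ (F[X] ∙ p)) (X : F[X]) with hTdef
  have hTX : ∀ v, T v = (X : F[X]) • v := fun v => rfl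
  have h00 : GoodEnd m (0 : Module.End F (F[X] ⧸ (F[X] ∙ p))) :=
    ⟨0, 0, by simp, by simp, by simp⟩
  obtain ⟨e, he⟩ : ∃ e, p.natDegree = e := ⟨_, rfl⟩
  rcases e with _ | l
  · have hu : IsUnit p := Polynomial.isUnit_iff_degree_eq_zero.mpr
      (by rw [Polynomial.degree_eq_natDegree hp, he]; rfl)
    have hs : (F[X] ∙ p) = ⊤ := Ideal.span_singleton_eq_top.mpr hu
    have : Subsingleton (F[X] ⧸ (F[X] ∙ p)) := Submodule.Quotient.subsingleton_iff.mpr hs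
    convert h00
    exact Subsingleton.elim _ _
  -- trace formula
  have htr : ∀ (x : ℕ → F) (u : Basis (Fin (l + 1)) F (F[X] ⧸ (F[X] ∙ p))),
      (∀ j : ℕ, ∀ h : j + 1 < l + 1,
      T (u ⟨j + 1, h⟩) = x (j + 1) • u ⟨j + 1, h⟩ + u ⟨j, by omega⟩) →
      u.repr (T (u 0)) 0 = LinearMap.trace F _ T - ∑ j : Fin l, x (j + 1) := by
    intro x u hu
    rw [LinearMap.trace_eq_matrix_trace F u, Matrix.trace, Fin.sum_univ_succ]
    have : ∀ j : Fin l, (LinearMap.toMatrix u u T).diag j.succ = x (j + 1) := by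
      intro j
      rw [Matrix.diag_apply, LinearMap.toMatrix_apply]
      have := hu j.1 (by omega)
      have h2 : j.succ = (⟨j.1 + 1, by omega⟩ : Fin (l+1)) := rfl
      rw [h2, this]
      simp [Finsupp.single_apply]
    simp only [this, Matrix.diag_apply, LinearMap.toMatrix_apply]
    ring
  rcases Nat.eq_zero_or_pos l with hl | hl
  · subst hl
    obtain ⟨u, hu⟩ := exists_cyc_basis p 0 he (fun _ => 1)
    by_cases hs : u.repr (T (u 0)) 0 = 0
    · have : T = 0 := by
        refine u.ext fun j => ?_
        obtain rfl : j = 0 := by ext; omega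
        rw [← u.sum_repr (T (u 0))]; simp [hs]
      rw [this]; exact h00
    · obtain ⟨a, b, hab, ha, hb, hb1⟩ := H _ hs
      exact good_of_basis m 0 hm T u (fun _ => 1) (by simp) (by simp) hu a b hab ha hb hb1
  · let x : F → ℕ → F := fun e j => if j = l then e else 1
    have hsum : ∑ j : Fin l, x 1 (j + 1) = (∑ j : Fin l, x 0 (j + 1)) + 1 := by
      obtain ⟨r, rfl⟩ : ∃ r, l = r + 1 := ⟨l - 1, by omega⟩
      rw [Fin.sum_univ_castSucc, Fin.sum_univ_castSucc]
      have : ∀ j : Fin r, ¬ ((j:ℕ) = r) := fun j => j.2.ne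
      simp [x, this]
    have fin : ∀ e : F, (e = 0 ∨ e = 1) → LinearMap.trace F _ T - ∑ j : Fin l, x e (j + 1) ≠ 0 →
        GoodEnd m T := by
      intro e hee hne
      obtain ⟨u, hu⟩ := exists_cyc_basis p l he (x e)
      rw [← htr (x e) u hu] at hne
      obtain ⟨a, b, hab, ha, hb, hb1⟩ := H _ hne
      refine good_of_basis m l hm T u (x e) ?_ ?_ hu a b hab ha hb hb1
      · intro j hj
        have : j ≠ l := by omega
        simp [x, this]
      · simpa [x] using hee
    by_cases h0 : LinearMap.trace F _ T - ∑ j : Fin l, x 0 (j + 1) = 0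
    · refine fin 1 (Or.inr rfl) ?_
      rw [hsum]
      intro h
      have : (1 : F) = 0 := by linear_combination h0 - h
      exact one_ne_zero this
    · exact fin 0 (Or.inl rfl) h0

open DirectSum in
lemma good_all {F V : Type*} [Field F] [AddCommGroup V] [Module F V] [FiniteDimensional F V]
    (m : ℕ) (hm : 1 ≤ m)
    (H : ∀ s : F, s ≠ 0 → ∃ a b : F, a + b = s ∧ a ^ m = 1 ∧ b ^ m = 1 ∧ b ≠ 1)
    (T : Module.End F V) : GoodEnd m T := by
  have hfin : Module.Finite F (AEval' T) := Module.Finite.equiv (AEval'.of T)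
  have : Module.Finite F[X] (AEval' T) := inferInstance
  have htors : Module.IsTorsion F[X] (AEval' T) := by
    intro v
    refine ⟨⟨minpoly F T, mem_nonZeroDivisors_of_ne_zero
      (minpoly.ne_zero (Algebra.IsIntegral.isIntegral T))⟩, ?_⟩
    obtain ⟨v, rfl⟩ := (AEval'.of T).surjective v
    change minpoly F T • (AEval.of F V T v) = 0
    rw [← AEval.of_aeval_smul, minpoly.aeval]; simp
  obtain ⟨ι, _, p, hp, e, ⟨φ⟩⟩ := Module.equiv_directSum_of_isTorsion htors
  have hg : ∀ i, GoodEnd m (Algebra.lsmul F F (F[X] ⧸ (F[X] ∙ (p i ^ e i))) (X : F[X])) := fun i =>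
    good_cyclic m hm H _ (pow_ne_zero _ (hp i).ne_zero)
  choose a b hab ha hb using hg
  let ψ : V ≃ₗ[F] ⨁ i : ι, F[X] ⧸ (F[X] ∙ (p i ^ e i)) := (AEval'.of T).trans (φ.restrictScalars F)
  have hψ : ∀ v, ψ (T v) = (X : F[X]) • ψ v := by
    intro v
    change φ (AEval'.of T (T v)) = _
    rw [← AEval'.X_smul_of, map_smul]; rfl
  have hpow : ∀ (c : ∀ i, Module.End F (F[X] ⧸ (F[X] ∙ (p i ^ e i)))) (n : ℕ),
      (DirectSum.lmap c : Module.End F (⨁ i : ι, F[X] ⧸ (F[X] ∙ (p i ^ e i)))) ^ n =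
      DirectSum.lmap (fun i => c i ^ n) := by
    intro c n
    induction n with
    | zero => ext; simp
    | succ n ih => rw [pow_succ, ih]; ext; simp [pow_succ]
  have hconj : ∀ (c : Module.End F (⨁ i : ι, F[X] ⧸ (F[X] ∙ (p i ^ e i)))) (n : ℕ),
      (ψ.symm.conj c) ^ n = ψ.symm.conj (c ^ n) := by
    intro c n
    exact (map_pow ψ.symm.conjRingEquiv c n).symm
  refine ⟨ψ.symm.conj (DirectSum.lmap a), ψ.symm.conj (DirectSum.lmap b), ?_, ?_, ?_⟩
  · apply LinearMap.ext
    intro v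
    apply ψ.injective
    rw [hψ]
    simp only [LinearMap.add_apply, LinearEquiv.conj_apply_apply, LinearEquiv.symm_symm, map_add,
      LinearEquiv.apply_symm_apply]
    ext i
    have := LinearMap.congr_fun (hab i) (ψ v i)
    rw [DirectSum.smul_apply]
    simpa using this
  · rw [hconj, hpow]; simp only [ha]
  · rw [hconj, hpow]; simp only [hb]

lemma ker_prod_le {F V : Type*} [Field F] [AddCommGroup V] [Module F V] (f : Module.End F V)
    (s : Finset F) : LinearMap.ker (aeval f (∏ c ∈ s, (X - C c))) ≤
      Submodule.span F {v | ∃ μ : F, f v = μ • v} := by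
  classical
  induction s using Finset.induction_on with
  | empty => simp [Module.End.one_eq_id, LinearMap.ker_id]
  | insert c s hc ih =>
    rw [Finset.prod_insert hc, ← Polynomial.sup_ker_aeval_eq_ker_aeval_mul_of_coprime]
    · refine sup_le ?_ ih
      intro v hv
      apply Submodule.subset_span
      refine ⟨c, ?_⟩
      simpa [sub_eq_zero, Module.algebraMap_end_apply] using hv
    · refine IsCoprime.prod_right fun i hi => ?_
      exact Polynomial.pairwise_coprime_X_sub_C Function.injective_id
        (by rintro rfl; exact hc hi)

lemma exists_root {F : Type*} [Field F] [Fintype F] (k n m : ℕ) (hk : 1 ≤ k)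
    (hmq : m ∣ Fintype.card F - 1) (hroot : ∀ x : F, x ^ m = 1 → ∃ y, y ^ k = x)
    (M : Matrix (Fin n) (Fin n) F) (hM : M ^ (m + 1) = M) :
    ∃ A : Matrix (Fin n) (Fin n) F, IsSplitSemisimple A ∧ A ^ k = M := by
  classical
  set f : Module.End F (Fin n → F) := Matrix.toLin' M with hf
  have hfm : f ^ (m + 1) = f := by rw [hf, ← Matrix.toLin'_pow, hM]
  obtain ⟨c, hc⟩ := hmq
  have hcard : 1 < Fintype.card F := Fintype.one_lt_card
  have hfq : f ^ (Fintype.card F) = f := by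
    have : ∀ c, f ^ (m * c + 1) = f := by
      intro c
      induction c with
      | zero => simp
      | succ c ih =>
        have : m * (c + 1) + 1 = m + (m * c + 1) := by ring
        rw [this, pow_add, ih, ← pow_succ, hfm]
    have h2 : Fintype.card F = m * c + 1 := by omega
    rw [h2, this]
  have hspan : ⊤ ≤ Submodule.span F {v | ∃ μ : F, f v = μ • v} := by
    refine le_trans ?_ (ker_prod_le f Finset.univ)
    have hprod : ∏ c ∈ (Finset.univ : Finset F), (X - C c) = X ^ Fintype.card F - X := by
      have h1 : (X ^ Fintype.card F - X : F[X]).Monic :=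
        Polynomial.monic_X_pow_sub (by rw [Polynomial.degree_X]; exact_mod_cast hcard)
      have := Polynomial.prod_multiset_X_sub_C_of_monic_of_roots_card_eq h1 (by
        rw [FiniteField.roots_X_pow_card_sub_X,
          FiniteField.X_pow_card_sub_X_natDegree_eq F hcard]; rfl)
      rw [FiniteField.roots_X_pow_card_sub_X] at this
      exact this
    rw [hprod]
    simp [hfq]
  let v0 := Module.Basis.ofSpan hspan
  have : Fintype ((linearIndepOn_empty F (id : (Fin n → F) → _)).extend
      (Set.empty_subset {v | ∃ μ : F, f v = μ • v})) := FiniteDimensional.fintypeBasisIndex v0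
  have hcd := Module.finrank_eq_card_basis v0
  rw [Module.finrank_fin_fun] at hcd
  let v : Basis (Fin n) F (Fin n → F) := v0.reindex (Fintype.equivFinOfCardEq hcd.symm)
  have hv : ∀ i, ∃ μ : F, f (v i) = μ • v i := by
    intro i
    have h1 : v i ∈ Set.range v0 := ⟨_, (Module.Basis.reindex_apply v0 _ i).symm⟩
    exact Module.Basis.ofSpan_subset hspan h1
  choose μ hμ using hv
  have hμ2 : ∀ i, ∃ y, y ^ k = μ i := by
    intro i
    by_cases h0 : μ i = 0
    · exact ⟨0, by rw [h0, zero_pow (by omega)]⟩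
    apply hroot
    have h1 := pow_apply_eig f _ _ (hμ i) (m + 1)
    rw [hfm, hμ i] at h1
    have h2 := smul_left_injective F (v.ne_zero i) h1
    rw [pow_succ] at h2
    exact (mul_right_cancel₀ h0 (by rw [one_mul]; exact h2)).symm
  choose y hy using hμ2
  let P : Matrix (Fin n) (Fin n) F := (Pi.basisFun F (Fin n)).toMatrix v
  let Q : Matrix (Fin n) (Fin n) F := v.toMatrix (Pi.basisFun F (Fin n))
  have hPQ : P * Q = 1 := Module.Basis.toMatrix_mul_toMatrix_flip _ _
  have hQP : Q * P = 1 := Module.Basis.toMatrix_mul_toMatrix_flip _ _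
  have hMP : M * P = P * Matrix.diagonal μ := by
    ext i j
    have := congrFun (hμ j) i
    rw [hf, Matrix.toLin'_apply] at this
    rw [Matrix.mul_diagonal, Matrix.mul_apply]
    simp only [Matrix.mulVec, dotProduct, Pi.smul_apply, smul_eq_mul] at this
    simp only [P, Module.Basis.toMatrix_apply, Pi.basisFun_repr]
    rw [this, mul_comm]
  let g : GL (Fin n) F := ⟨Q, P, hQP, hPQ⟩
  refine ⟨P * Matrix.diagonal y * Q, ⟨g, y, ?_⟩, ?_⟩
  · change Q * (P * Matrix.diagonal y * Q) * P = _
    calc Q * (P * Matrix.diagonal y * Q) * P = (Q * P) * Matrix.diagonal y * (Q * P) := by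
          simp only [Matrix.mul_assoc]
      _ = _ := by rw [hQP]; simp
  · have hpw : ∀ j : ℕ, (P * Matrix.diagonal y * Q) ^ j = P * Matrix.diagonal (y ^ j) * Q := by
      intro j
      induction j with
      | zero => simp [hPQ]
      | succ j ih =>
        rw [pow_succ, ih]
        calc P * Matrix.diagonal (y ^ j) * Q * (P * Matrix.diagonal y * Q)
            = P * (Matrix.diagonal (y ^ j) * (Q * P) * Matrix.diagonal y) * Q := by
              simp only [Matrix.mul_assoc]
          _ = _ := by rw [hQP, mul_one, Matrix.diagonal_mul_diagonal, pow_succ]; rfl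
    have hyk : y ^ k = μ := funext hy
    rw [hpw, hyk, ← hMP, Matrix.mul_assoc, hPQ, mul_one]

end LA

theorem stmt8 (F : Type*) [Field F] [Fintype F] (k n : ℕ) (hk : 1 ≤ k) (hn : 2 ≤ n)
    (d : ℕ) (hd : d = Nat.gcd k (Fintype.card F - 1))
    (hq : Fintype.card F ≥ (d - 1) ^ 4 + 6 * d) :
    ∀ M : Matrix (Fin n) (Fin n) F, ∃ A B : Matrix (Fin n) (Fin n) F,
      IsSplitSemisimple A ∧ IsSplitSemisimple B ∧ M = A ^ k + B ^ k := by
  intro M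
  obtain ⟨m, hm, hmq, hroot, H⟩ := nt_main (F := F) k d hk hd hq
  obtain ⟨a, b, hab, ha, hb⟩ := good_all m hm H (Matrix.toLin' M)
  have key : ∀ c : Module.End F (Fin n → F), c ^ (m + 1) = c →
      (LinearMap.toMatrix' c) ^ (m + 1) = LinearMap.toMatrix' c := by
    intro c hc
    apply Matrix.toLin'.injective
    rw [Matrix.toLin'_pow, Matrix.toLin'_toMatrix', hc]
  obtain ⟨A, hA, hA'⟩ := exists_root k n m hk hmq hroot _ (key a ha)
  obtain ⟨B, hB, hB'⟩ := exists_root k n m hk hmq hroot _ (key b hb)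
  refine ⟨A, B, hA, hB, ?_⟩
  rw [hA', hB', ← map_add, ← hab, LinearMap.toMatrix'_toLin']
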